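/- arXiv:2009.05820 — 2 statements merged into one kernel-verified Lean document; each statement's English description precedes it below -/
import Mathlib

section
/- For all dimensions d ≥ 1 and all n ≥ 1, every set of n points in [0,1]^d admits an empty axis-parallel box of volume at least (1/n)·(2d/e)·(1 − 4d·n^{−1/d}). -/
open Finset

/-- Truncated logarithmic potential. -/
noncomputable def phiPot {d : ℕ} (h : ℝ) (x : Fin d → ℝ) : ℝ := max 0 (-Real.log (‖x‖ / h))

lemma phiPot_nonneg {d : ℕ} (h : ℝ) (x : Fin d → ℝ) : 0 ≤ phiPot h x := le_max_left _ _

lemma phiPot_meas {d : ℕ} (h : ℝ) : Measurable (phiPot (d := d) h) := by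
  unfold phiPot
  fun_prop

lemma phiPot_exp {d : ℕ} (h : ℝ) (hh : 0 < h) (x : Fin d → ℝ) (hx : x ≠ 0) :
    h * Real.exp (-phiPot h x) ≤ ‖x‖ := by
  have hx' : 0 < ‖x‖ := norm_pos_iff.mpr hx
  have h1 : -phiPot h x ≤ Real.log (‖x‖ / h) := by
    have := le_max_right 0 (-Real.log (‖x‖ / h))
    unfold phiPot; linarith
  calc h * Real.exp (-phiPot h x) ≤ h * Real.exp (Real.log (‖x‖ / h)) := by gcongr
    _ = ‖x‖ := by rw [Real.exp_log (by positivity)]; field_simp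

lemma phiPot_lint {d : ℕ} (hd : 1 ≤ d) (h : ℝ) (hh : 0 < h) :
    ∫⁻ x : Fin d → ℝ, ENNReal.ofReal (phiPot h x) ≤ ENNReal.ofReal ((2 * h) ^ d / d) := by
  have hd0 : (0:ℝ) < d := by exact_mod_cast hd
  rw [MeasureTheory.lintegral_eq_lintegral_meas_lt _
    (Filter.Eventually.of_forall (phiPot_nonneg h)) (phiPot_meas h).aemeasurable]
  have key : ∀ t ∈ Set.Ioi (0:ℝ), MeasureTheory.volume {x : Fin d → ℝ | t < phiPot h x} ≤
      ENNReal.ofReal ((2 * h) ^ d * Real.exp (-d * t)) := by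
    intro t ht
    have ht : 0 < t := ht
    have hsub : {x : Fin d → ℝ | t < phiPot h x} ⊆ Metric.ball 0 (h * Real.exp (-t)) := by
      intro x hx
      have hx : t < phiPot h x := hx
      rw [mem_ball_zero_iff]
      unfold phiPot at hx
      rcases lt_max_iff.mp hx with h1 | h1
      · linarith
      · by_cases hx0 : ‖x‖ = 0
        · simp [hx0] at h1; linarith
        have hp : 0 < ‖x‖ := lt_of_le_of_ne (norm_nonneg _) (Ne.symm hx0)
        have : Real.log (‖x‖ / h) < -t := by linarith
        rw [Real.log_lt_iff_lt_exp (by positivity), div_lt_iff₀ hh] at this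
        linarith
    refine (MeasureTheory.measure_mono hsub).trans ?_
    rw [Real.volume_pi_ball _ (by positivity)]
    apply ENNReal.ofReal_le_ofReal
    rw [Fintype.card_fin, ← mul_assoc, mul_pow, ← Real.exp_nat_mul]
    apply le_of_eq; congr 2; ring
  refine (MeasureTheory.setLIntegral_mono (by fun_prop) key).trans ?_
  have hint : MeasureTheory.IntegrableOn (fun t => (2 * h) ^ d * Real.exp (-d * t)) (Set.Ioi (0:ℝ)) :=
    (integrableOn_exp_mul_Ioi (by linarith) 0).const_mul _
  rw [← MeasureTheory.ofReal_integral_eq_lintegral_ofReal hint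
    (Filter.Eventually.of_forall fun t => by positivity)]
  apply ENNReal.ofReal_le_ofReal
  rw [MeasureTheory.integral_const_mul, integral_exp_mul_Ioi (by linarith)]
  apply le_of_eq
  simp
  ring

lemma exists_center {d : ℕ} (hd : 1 ≤ d) (s : ℝ) (hs : 0 < s) (hs1 : s < 1)
    (P : Finset (Fin d → ℝ)) :
    ∃ c : Fin d → ℝ, (∀ i, s / 2 ≤ c i ∧ c i ≤ 1 - s / 2) ∧ c ∉ P ∧
      ∑ p ∈ P, phiPot (s / 2) (p - c) ≤ P.card * (s ^ d / d) / (1 - s) ^ d := by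
  have hd0 : (0:ℝ) < d := by exact_mod_cast hd
  haveI : Nonempty (Fin d) := ⟨⟨0, hd⟩⟩
  have hpos : 0 < (1 - s) ^ d := pow_pos (by linarith) _
  set K : Set (Fin d → ℝ) := Set.Icc (fun _ => s / 2) (fun _ => 1 - s / 2) with hK
  have hKv : MeasureTheory.volume K = ENNReal.ofReal ((1 - s) ^ d) := by
    rw [hK, Real.volume_Icc_pi]
    rw [Finset.prod_const, Finset.card_univ, Fintype.card_fin, ← ENNReal.ofReal_pow (by linarith)]
    congr 2; ring
  by_contra hcon
  push Not at hcon
  set A : ℝ := P.card * (s ^ d / d) / (1 - s) ^ d with hA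
  have hA0 : 0 ≤ A := by positivity
  set F : (Fin d → ℝ) → ENNReal :=
    fun c => ∑ p ∈ P, ENNReal.ofReal (phiPot (s / 2) (p - c)) with hF
  have hFm : Measurable F := by
    refine Finset.measurable_sum _ fun p _ => ?_
    exact ((phiPot_meas (s/2)).comp (measurable_const.sub measurable_id)).ennreal_ofReal
  have hFi : ∫⁻ c in K, F c ≤ ENNReal.ofReal (P.card * (s ^ d / d)) := by
    refine (MeasureTheory.setLIntegral_le_lintegral _ _).trans ?_
    rw [MeasureTheory.lintegral_finsetSum]
    · rw [ENNReal.ofReal_mul (by positivity), ENNReal.ofReal_natCast, ← nsmul_eq_mul]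
      apply Finset.sum_le_card_nsmul
      intro p _
      rw [MeasureTheory.lintegral_sub_left_eq_self (fun x => ENNReal.ofReal (phiPot (s / 2) x)) p]
      have := phiPot_lint hd (s / 2) (by linarith)
      rwa [show 2 * (s / 2) = s by ring] at this
    · intro p _
      exact ((phiPot_meas (s/2)).comp (measurable_const.sub measurable_id)).ennreal_ofReal
  have hKne : MeasureTheory.volume.restrict K ≠ 0 := by
    rw [Ne, MeasureTheory.Measure.restrict_eq_zero, hKv]
    simpa using hpos
  have hN : (MeasureTheory.volume.restrict K) (Kᶜ ∪ (P : Set (Fin d → ℝ))) = 0 := by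
    refine MeasureTheory.measure_union_null ?_ ?_
    · rw [MeasureTheory.Measure.restrict_apply (measurableSet_Icc.compl), Set.compl_inter_self]
      exact MeasureTheory.measure_empty
    · refine MeasureTheory.Measure.absolutelyContinuous_of_le MeasureTheory.Measure.restrict_le_self ?_
      exact (Finset.countable_toSet P).measure_zero _
  haveI : MeasureTheory.IsFiniteMeasure (MeasureTheory.volume.restrict K) :=
    ⟨by rw [MeasureTheory.Measure.restrict_apply_univ, hKv]; exact ENNReal.ofReal_lt_top⟩
  obtain ⟨c, hcN, hc⟩ := MeasureTheory.exists_notMem_null_le_laverage hKne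
    hFm.aemeasurable hN
  simp only [Set.mem_union, Set.mem_compl_iff, not_or, not_not] at hcN
  have h1 := hcon c (fun i => ⟨hcN.1.1 i, hcN.1.2 i⟩) (by simpa using hcN.2)
  rw [MeasureTheory.setLAverage_eq, hKv] at hc
  have h2 : F c ≤ ENNReal.ofReal A := by
    refine hc.trans ?_
    rw [hA, ENNReal.ofReal_div_of_pos hpos]
    gcongr
  have h3 : F c = ENNReal.ofReal (∑ p ∈ P, phiPot (s / 2) (p - c)) := by
    rw [ENNReal.ofReal_sum_of_nonneg fun p _ => phiPot_nonneg _ _]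
  rw [h3, ENNReal.ofReal_le_ofReal_iff hA0] at h2
  linarith

lemma exp_amgm (A B : ℝ) : 2 * Real.exp (-(A + B) / 2) ≤ Real.exp (-A) + Real.exp (-B) := by
  have h1 : Real.exp (-A) = Real.exp (-A / 2) ^ 2 := by rw [← Real.exp_nat_mul]; congr 1; push_cast; ring
  have h2 : Real.exp (-B) = Real.exp (-B / 2) ^ 2 := by rw [← Real.exp_nat_mul]; congr 1; push_cast; ring
  have h3 : Real.exp (-(A + B) / 2) = Real.exp (-A / 2) * Real.exp (-B / 2) := by
    rw [← Real.exp_add]; congr 1; ring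
  rw [h1, h2, h3]
  nlinarith [sq_nonneg (Real.exp (-A / 2) - Real.exp (-B / 2))]

lemma box_of_center {d : ℕ} (hd : 1 ≤ d) (s : ℝ) (hs : 0 < s)
    (P : Finset (Fin d → ℝ)) (c : Fin d → ℝ)
    (hc : ∀ i, s / 2 ≤ c i ∧ c i ≤ 1 - s / 2) (hcP : c ∉ P) :
    ∃ a b : Fin d → ℝ,
      (∀ i, 0 ≤ a i ∧ a i < b i ∧ b i ≤ 1) ∧
      (∀ p ∈ P, ∃ i, p i ∉ Set.Ioo (a i) (b i)) ∧
      s ^ d * Real.exp (-(∑ p ∈ P, phiPot (s / 2) (p - c)) / 2) ≤ ∏ i, (b i - a i) := by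
  classical
  haveI : Nonempty (Fin d) := ⟨⟨0, hd⟩⟩
  have hex : ∀ p : Fin d → ℝ, ∃ i, |p i - c i| = ‖p - c‖ := by
    intro p
    obtain ⟨i, hi⟩ := Finite.exists_max (fun i => ‖(p - c) i‖)
    refine ⟨i, le_antisymm (norm_le_pi_norm (p - c) i) ?_⟩
    exact (pi_norm_le_iff_of_nonempty _).mpr hi
  choose ix hix using hex
  set w : (Fin d → ℝ) → ℝ := fun p => phiPot (s / 2) (p - c) with hw
  have hw0 : ∀ p, 0 ≤ w p := fun p => phiPot_nonneg _ _
  set U : Fin d → ℝ := fun i => ∑ p ∈ (P.filter (fun p => ix p = i)).filter (fun p => c i < p i), w p with hU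
  set L : Fin d → ℝ := fun i => ∑ p ∈ (P.filter (fun p => ix p = i)).filter (fun p => ¬ c i < p i), w p with hL
  have hUL : ∀ i, U i + L i = ∑ p ∈ P.filter (fun p => ix p = i), w p := fun i =>
    Finset.sum_filter_add_sum_filter_not _ _ _
  have hU0 : ∀ i, 0 ≤ U i := fun i => Finset.sum_nonneg fun p _ => hw0 p
  have hL0 : ∀ i, 0 ≤ L i := fun i => Finset.sum_nonneg fun p _ => hw0 p
  have hle : ∀ x : ℝ, 0 ≤ x → s / 2 * Real.exp (-x) ≤ s / 2 := by
    intro x hx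
    have : Real.exp (-x) ≤ 1 := Real.exp_le_one_iff.mpr (by linarith)
    nlinarith
  have hgt : ∀ x : ℝ, 0 < s / 2 * Real.exp (-x) := fun x => by positivity
  refine ⟨fun i => c i - s / 2 * Real.exp (-L i), fun i => c i + s / 2 * Real.exp (-U i), ?_, ?_, ?_⟩
  · intro i
    have := hle _ (hU0 i); have := hle _ (hL0 i); have := hgt (U i); have := hgt (L i)
    have := hc i
    refine ⟨?_, ?_, ?_⟩ <;> simp only <;> linarith
  · intro p hp
    refine ⟨ix p, ?_⟩
    have hne : p - c ≠ 0 := fun h => hcP (by rw [← sub_eq_zero.mp h]; exact hp)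
    have h1 := phiPot_exp (s / 2) (by linarith) (p - c) hne
    have h2 := hix p
    rintro ⟨ha, hb⟩
    simp only at ha hb
    by_cases hlt : c (ix p) < p (ix p)
    · rw [abs_of_pos (by linarith)] at h2
      have h3 : w p ≤ U (ix p) :=
        Finset.single_le_sum (f := w) (fun q _ => hw0 q) (by simp [hp, hlt])
      have h4 : s / 2 * Real.exp (-U (ix p)) ≤ s / 2 * Real.exp (-w p) := by gcongr
      simp only [hw] at h4
      linarith
    · rw [abs_of_nonpos (by linarith)] at h2
      have h3 : w p ≤ L (ix p) :=
        Finset.single_le_sum (f := w) (fun q _ => hw0 q) (by simpa [hp] using hlt)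
      have h4 : s / 2 * Real.exp (-L (ix p)) ≤ s / 2 * Real.exp (-w p) := by gcongr
      simp only [hw] at h4
      linarith
  · have hsum : ∑ p ∈ P, w p = ∑ i, (U i + L i) := by
      simp_rw [hUL]
      exact (Finset.sum_fiberwise P ix w).symm
    calc s ^ d * Real.exp (-(∑ p ∈ P, w p) / 2) = ∏ i, (s * Real.exp (-(U i + L i) / 2)) := by
          rw [Finset.prod_mul_distrib, ← Real.exp_sum, hsum]
          simp only [Finset.prod_const, Finset.card_univ, Fintype.card_fin, ← Finset.sum_div,
            Finset.sum_neg_distrib]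
      _ ≤ _ := by
          apply Finset.prod_le_prod
          · intro i _; positivity
          · intro i _
            have := mul_le_mul_of_nonneg_left (exp_amgm (U i) (L i)) (by linarith : 0 ≤ s / 2)
            linarith

lemma two_mul_le_two_pow (d : ℕ) (hd : 1 ≤ d) : 2 * d ≤ 2 ^ d := by
  induction d, hd using Nat.le_induction with
  | base => norm_num
  | succ k hk ih => rw [pow_succ]; omega

/-- Every `n`-point set in `[0,1]^d` admits an empty axis-parallel box of volume at least
`(1/n)·(2d/e)·(1 − 4d·n^{−1/d})`. -/
theorem stmt_2 (d n : ℕ) (hd : 1 ≤ d) (hn : 1 ≤ n) (P : Finset (Fin d → ℝ))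
    (hPcard : P.card = n) (hP : ∀ p ∈ P, ∀ i, p i ∈ Set.Icc (0:ℝ) 1) :
    ∃ a b : Fin d → ℝ,
      (∀ i, 0 ≤ a i ∧ a i < b i ∧ b i ≤ 1) ∧
      (∀ p ∈ P, ∃ i, p i ∉ Set.Ioo (a i) (b i)) ∧
      (1 / (n:ℝ)) * (2 * d / Real.exp 1) * (1 - 4 * d * (n:ℝ) ^ (-(1 / (d:ℝ)))) ≤
        ∏ i, (b i - a i) := by
  have hd0 : (0:ℝ) < d := by exact_mod_cast hd
  have hn0 : (0:ℝ) < n := by exact_mod_cast hn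
  set t : ℝ := (2 * d / n : ℝ) ^ (1 / (d:ℝ)) with ht
  have ht0 : 0 < t := by positivity
  have htd : t ^ d = 2 * d / n := by
    rw [ht, one_div, Real.rpow_inv_natCast_pow (by positivity) (by omega)]
  set r : ℝ := (n:ℝ) ^ (-(1 / (d:ℝ))) with hr
  have hr0 : 0 < r := by positivity
  have htr : t ≤ 2 * r := by
    have hrd : r ^ d = 1 / n := by
      rw [hr, Real.rpow_neg hn0.le, inv_pow, one_div, Real.rpow_inv_natCast_pow hn0.le (by omega),
        one_div]
    refine le_of_pow_le_pow_left₀ (n := d) (by omega) (by positivity) ?_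
    rw [htd, mul_pow, hrd]
    have : (2 * d : ℝ) ≤ 2 ^ d := by exact_mod_cast two_mul_le_two_pow d hd
    rw [mul_one_div]
    gcongr
  set s : ℝ := t / (1 + t) with hs
  have hs0 : 0 < s := by positivity
  have hs1 : s < 1 := by rw [hs, div_lt_one (by positivity)]; linarith
  have h1s : 1 - s = 1 / (1 + t) := by rw [hs]; field_simp; ring
  obtain ⟨c, hc, hcP, hsum⟩ := exists_center hd s hs0 hs1 P
  obtain ⟨a, b, hab, hemp, hvol⟩ := box_of_center hd s hs0 P c hc hcP
  refine ⟨a, b, hab, hemp, le_trans ?_ hvol⟩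
  have h2 : (P.card * (s ^ d / d) / (1 - s) ^ d : ℝ) = 2 := by
    rw [hPcard, h1s, hs, div_pow, div_pow, htd]
    field_simp
    simp
  rw [h2] at hsum
  have h3 : s ^ d * Real.exp (-1) ≤ s ^ d * Real.exp (-(∑ p ∈ P, phiPot (s / 2) (p - c)) / 2) := by
    gcongr; linarith
  refine le_trans ?_ h3
  have h4 : s ^ d = 2 * d / n * (1 - s) ^ d := by
    rw [h1s, hs, div_pow, div_pow, htd]; simp [div_eq_mul_inv]
  have h5 : 1 - 4 * d * r ≤ (1 - s) ^ d := by
    have hb := one_add_mul_le_pow (a := -s) (by linarith) d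
    have hst : s ≤ t := div_le_self ht0.le (by linarith)
    have : (d:ℝ) * s ≤ d * (2 * r) := by gcongr; linarith
    have : 0 < d * r := by positivity
    rw [← sub_eq_add_neg] at hb
    linarith
  rw [h4, Real.exp_neg]
  calc _ ≤ (1 / (n:ℝ)) * (2 * d / Real.exp 1) * (1 - s) ^ d := by gcongr
    _ = _ := by field_simp
end

section
/- For every d ≥ 3 and every n ≥ 1, there exists a set of at most n points in [0,1]^d such that every axis-parallel open box contained in [0,1]^d of volume greater than 8000·d^2·log(d)/n contains at least one point of the set. -/
open Finset

namespace Disp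

open Polynomial

/-- The polynomial with a given list of coefficients. -/
noncomputable def pol {F : Type*} [Field F] (n : ℕ) (c : Fin n → F) : F[X] :=
  ((degreeLTEquiv F n).symm c : F[X])

section
variable {F : Type*} [Field F]

lemma pol_degree (n : ℕ) (c : Fin n → F) : (pol n c).degree < n :=
  mem_degreeLT.1 ((degreeLTEquiv F n).symm c).2

lemma pol_surj (n : ℕ) (p : F[X]) (hp : p.degree < n) : ∃ c, pol n c = p :=
  ⟨degreeLTEquiv F n ⟨p, mem_degreeLT.2 hp⟩, by simp [pol]⟩

lemma pol_sub (n : ℕ) (c c' : Fin n → F) : pol n (c - c') = pol n c - pol n c' := by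
  simp [pol]

lemma pol_eq_zero (n : ℕ) (c : Fin n → F) (h : pol n c = 0) : c = 0 := by
  have : (degreeLTEquiv F n).symm c = 0 := Subtype.ext h
  simpa using this

lemma pol_coeff (n : ℕ) (c : Fin n → F) (j : Fin n) : (pol n c).coeff j = c j := by
  have h : (degreeLTEquiv F n) ((degreeLTEquiv F n).symm c) j = c j := by simp
  rw [← h]; rfl

lemma pol_coeff_ge (n : ℕ) (c : Fin n → F) (j : ℕ) (h : n ≤ j) : (pol n c).coeff j = 0 :=
  coeff_eq_zero_of_degree_lt ((pol_degree n c).trans_le (by exact_mod_cast h))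

lemma crt_zero {d : ℕ} (a : Fin d → F) (ha : Function.Injective a) (k : Fin d → ℕ) (p : F[X])
    (hp : p.degree < (∑ i, k i : ℕ)) (h : ∀ i, ∀ j < k i, (taylor (a i) p).coeff j = 0) : p = 0 := by
  have hd : ∀ i, (X - C (a i)) ^ k i ∣ p := by
    intro i
    rw [X_sub_C_pow_dvd_iff, ← taylor_apply, X_pow_dvd_iff]
    exact h i
  have : ∏ i, (X - C (a i)) ^ k i ∣ p := by
    apply Finset.prod_dvd_of_coprime
    · intro i _ j _ hij
      exact IsCoprime.pow (pairwise_coprime_X_sub_C ha hij)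
    · intro i _; exact hd i
  by_contra hne
  have h2 := degree_le_of_dvd this hne
  rw [degree_prod] at h2
  simp only [degree_pow, degree_X_sub_C, nsmul_eq_mul, mul_one] at h2
  push_cast at hp
  exact absurd hp (not_lt.2 h2)

lemma crt_surj [Fintype F] {d : ℕ} (a : Fin d → F) (ha : Function.Injective a) (k : Fin d → ℕ)
    (τ : Fin d → ℕ → F) :
    ∃ g : F[X], g.degree < (∑ i, k i : ℕ) ∧ ∀ i, ∀ j < k i, (taylor (a i) g).coeff j = τ i j := by
  classical
  let Ψ : (Fin (∑ i, k i) → F) → (∀ i, Fin (k i) → F) :=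
    fun c i j => (taylor (a i) (pol _ c)).coeff j
  have hinj : Function.Injective Ψ := by
    intro c c' h
    rw [← sub_eq_zero]
    apply pol_eq_zero
    apply crt_zero a ha k _ (pol_degree _ _)
    intro i j hj
    have := congrFun (congrFun h i) ⟨j, hj⟩
    simp only [Ψ] at this
    simp [pol_sub, this]
  have hbij : Function.Bijective Ψ := by
    rw [Fintype.bijective_iff_injective_and_card]
    refine ⟨hinj, ?_⟩
    simp [Fintype.card_pi, Finset.prod_pow_eq_pow_sum]
  obtain ⟨c, hc⟩ := hbij.2 (fun i j => τ i j)
  refine ⟨pol _ c, pol_degree _ _, fun i j hj => ?_⟩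
  exact congrFun (congrFun hc i) ⟨j, hj⟩

lemma count [Fintype F] [DecidableEq F] {d : ℕ} (a : Fin d → F) (ha : Function.Injective a)
    (n : ℕ) (hn : 4 * d ≤ n)
    (P : Fin d → F[X]) (hP : ∀ i, (P i).coeff 0 ≠ 0) (h : Fin d → Fin 4 → F)
    (D : Fin d → Finset (Fin 4 → F)) :
    (univ.filter (fun c : Fin n → F =>
      ∀ i, (fun j : Fin 4 => h i j + (P i * taylor (a i) (pol n c)).coeff j) ∈ D i)).card
      = (∏ i, (D i).card) * Fintype.card F ^ (n - 4 * d) := by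
  let Ψ : (Fin n → F) → (Fin d → Fin 4 → F) × (Fin (n - 4 * d) → F) :=
    fun c => (fun i j => h i j + (P i * taylor (a i) (pol n c)).coeff j,
      fun j => c ⟨4 * d + j, by omega⟩)
  have hinj : Function.Injective Ψ := by
    intro c c' hc
    have h1 := congrArg Prod.fst hc
    have h2 := congrArg Prod.snd hc
    simp only [Ψ] at h1 h2
    rw [← sub_eq_zero]
    apply pol_eq_zero
    have hdeg : (pol n (c - c')).degree < (∑ i : Fin d, 4 : ℕ) := by
      rw [degree_lt_iff_coeff_zero]
      intro j hj
      simp at hj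
      by_cases hjn : j < n
      · rw [show j = ((⟨j, hjn⟩ : Fin n) : ℕ) from rfl, pol_coeff]
        have := congrFun h2 ⟨j - 4 * d, by omega⟩
        simp only [show 4 * d + (j - 4 * d) = j by omega] at this
        simp [this]
      · exact pol_coeff_ge _ _ _ (by omega)
    apply crt_zero a ha (fun _ => 4) _ hdeg
    intro i
    rw [← X_pow_dvd_iff]
    have h3 : X ^ 4 ∣ P i * taylor (a i) (pol n (c - c')) := by
      rw [X_pow_dvd_iff]
      intro j hj
      have := congrFun (congrFun h1 i) ⟨j, hj⟩
      simp only [add_right_inj] at this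
      simp [pol_sub, mul_sub, this]
    refine IsCoprime.dvd_of_dvd_mul_left ?_ h3
    apply IsCoprime.pow_left
    rw [Polynomial.prime_X.coprime_iff_not_dvd, X_dvd_iff]
    exact hP i
  have hbij : Function.Bijective Ψ := by
    rw [Fintype.bijective_iff_injective_and_card]
    refine ⟨hinj, ?_⟩
    simp only [Fintype.card_pi, Finset.prod_const, Fintype.card_prod, Finset.card_univ, Fintype.card_fin]
    rw [← pow_mul, ← pow_add]; congr 1; omega
  have : (Fintype.piFinset D ×ˢ (univ : Finset (Fin (n - 4 * d) → F))).card
      = (∏ i, (D i).card) * Fintype.card F ^ (n - 4 * d) := by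
    simp [Finset.card_product, Fintype.card_piFinset]
  rw [← this]
  apply Finset.card_equiv (Equiv.ofBijective Ψ hbij)
  intro c
  simp [Ψ, Fintype.mem_piFinset]

end

/-- Random choice: a few elements hit all the large sets of a small family. -/
lemma hitting {ι U Λ : Type*} [Fintype U] [DecidableEq U] [Fintype Λ]
    (S : ι → Finset U) (key : ι → Λ) (hkey : ∀ i i', key i = key i' → S i = S i')
    (a : ℕ) (T : ℝ) (hU : 0 < Fintype.card U) (hT : (Fintype.card Λ : ℝ) < Real.exp T) :
    ∃ α : Fin a → U, ∀ i, T * Fintype.card U ≤ (S i).card * a → ∃ t, α t ∈ S i := by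
  classical
  by_contra hcon
  push Not at hcon
  let Bad : Λ → Finset (Fin a → U) := fun p => univ.filter (fun α =>
    ∃ i, key i = p ∧ T * Fintype.card U ≤ (S i).card * a ∧ ∀ t, α t ∉ S i)
  have hcov : (univ : Finset (Fin a → U)) ⊆ univ.biUnion Bad := by
    intro α _
    obtain ⟨i, hi, ht⟩ := hcon α
    simp only [mem_biUnion, mem_univ, true_and, Bad, mem_filter]
    exact ⟨key i, i, rfl, hi, ht⟩
  have hUr : (0:ℝ) < Fintype.card U := by exact_mod_cast hU
  have hbad : ∀ p, ((Bad p).card : ℝ) ≤ (Fintype.card U : ℝ) ^ a * Real.exp (-T) := by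
    intro p
    by_cases hp : ∃ i, key i = p ∧ T * Fintype.card U ≤ (S i).card * a
    · obtain ⟨i, hi, hc⟩ := hp
      have hsub : Bad p ⊆ Fintype.piFinset (fun _ => (S i)ᶜ) := by
        intro α hα
        simp only [Bad, mem_filter, mem_univ, true_and] at hα
        obtain ⟨i', hi', _, ht⟩ := hα
        rw [hkey i' i (hi'.trans hi.symm)] at ht
        simpa [Fintype.mem_piFinset] using ht
      have h1 : ((Bad p).card : ℝ) ≤ ((S i)ᶜ.card : ℝ) ^ a := by
        have := card_le_card hsub
        rw [Fintype.card_piFinset] at this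
        simp only [prod_const, card_univ, Fintype.card_fin] at this
        exact_mod_cast this
      have h2 : ((S i)ᶜ.card : ℝ) ≤ Fintype.card U * Real.exp (-((S i).card / Fintype.card U)) := by
        rw [card_compl, Nat.cast_sub (card_le_univ _)]
        have := Real.add_one_le_exp (-((S i).card / Fintype.card U : ℝ))
        calc (Fintype.card U : ℝ) - (S i).card
            = Fintype.card U * (-((S i).card / Fintype.card U : ℝ) + 1) := by field_simp; ring
          _ ≤ _ := by gcongr
      calc ((Bad p).card : ℝ) ≤ _ := h1
        _ ≤ (Fintype.card U * Real.exp (-((S i).card / Fintype.card U))) ^ a := by gcongr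
        _ = (Fintype.card U : ℝ) ^ a * Real.exp (a * (-((S i).card / Fintype.card U))) := by
          rw [mul_pow, ← Real.exp_nat_mul]
        _ ≤ _ := by
          gcongr
          rw [mul_neg, neg_le_neg_iff, mul_div_assoc', le_div_iff₀ hUr]
          linarith
    · have : Bad p = ∅ := by
        rw [Finset.eq_empty_iff_forall_notMem]
        intro α hα
        simp only [Bad, mem_filter, mem_univ, true_and] at hα
        obtain ⟨i', hi', hc, ht⟩ := hα
        exact hp ⟨i', hi', hc⟩
      rw [this]; simp; positivity
  have h1 : ((Fintype.card U : ℝ)) ^ a ≤ ∑ p, ((Bad p).card : ℝ) := by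
    have := (card_le_card hcov).trans card_biUnion_le
    simp only [card_univ, Fintype.card_pi, prod_const, Fintype.card_fin] at this
    exact_mod_cast this
  have h2 : ∑ p, ((Bad p).card : ℝ) ≤ Fintype.card Λ * ((Fintype.card U : ℝ) ^ a * Real.exp (-T)) := by
    calc _ ≤ ∑ p : Λ, ((Fintype.card U : ℝ) ^ a * Real.exp (-T)) := sum_le_sum fun p _ => hbad p
      _ = _ := by simp
  have h3 : (Fintype.card Λ : ℝ) * Real.exp (-T) < 1 := by
    rw [Real.exp_neg, ← div_eq_mul_inv, div_lt_one (Real.exp_pos _)]; exact hT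
  have h4 : (0:ℝ) < (Fintype.card U : ℝ) ^ a := by positivity
  nlinarith

end Disp

namespace Disp

lemma digit_sum (q : ℕ) (hq : 0 < q) (N v : ℕ) :
    ∑ j ∈ range N, (((v / q ^ (N - 1 - j)) % q : ℕ) : ℝ) / (q:ℝ) ^ (j + 1)
      = ((v % q ^ N : ℕ) : ℝ) / (q:ℝ) ^ N := by
  have hq' : (q:ℝ) ≠ 0 := by positivity
  induction N generalizing v with
  | zero => simp [Nat.mod_one]
  | succ N ih =>
    rw [sum_range_succ]
    have h1 : ∀ j ∈ range N, (((v / q ^ (N + 1 - 1 - j)) % q : ℕ) : ℝ) / (q:ℝ) ^ (j + 1)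
        = ((((v / q) / q ^ (N - 1 - j)) % q : ℕ) : ℝ) / (q:ℝ) ^ (j + 1) := by
      intro j hj
      have := mem_range.1 hj
      rw [Nat.div_div_eq_div_mul, ← pow_succ', show N - 1 - j + 1 = N + 1 - 1 - j by omega]
    rw [sum_congr rfl h1, ih, pow_succ' q N, Nat.mod_mul]
    simp only [Nat.add_sub_cancel, Nat.sub_self, pow_zero, Nat.div_one]
    push_cast
    field_simp
    ring

lemma digit_tail (q : ℕ) (hq : 0 < q) (δ : ℕ → ℕ) (hδ : ∀ j, δ j < q) (N m : ℕ) (h : N ≤ m) :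
    ∑ j ∈ range N, (δ j : ℝ) / (q:ℝ) ^ (j + 1) ≤ ∑ j ∈ range m, (δ j : ℝ) / (q:ℝ) ^ (j + 1) ∧
    ∑ j ∈ range m, (δ j : ℝ) / (q:ℝ) ^ (j + 1) + 1 / (q:ℝ) ^ m ≤
      ∑ j ∈ range N, (δ j : ℝ) / (q:ℝ) ^ (j + 1) + 1 / (q:ℝ) ^ N := by
  have hq' : (0:ℝ) < q := by positivity
  induction m, h using Nat.le_induction with
  | base => simp
  | succ m _ ih =>
    rw [sum_range_succ]
    have h0 : (0:ℝ) ≤ (δ m : ℝ) / (q:ℝ) ^ (m + 1) := by positivity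
    have h1 : (δ m : ℝ) / (q:ℝ) ^ (m + 1) + 1 / (q:ℝ) ^ (m + 1) ≤ 1 / (q:ℝ) ^ m := by
      have : ((δ m + 1 : ℕ) : ℝ) ≤ q := by exact_mod_cast hδ m
      push_cast at this
      rw [← add_div, div_le_div_iff₀ (by positivity) (by positivity), pow_succ]
      have : (0:ℝ) < (q:ℝ) ^ m := by positivity
      nlinarith
    constructor
    · linarith [ih.1]
    · linarith [ih.2]

/-- If the first digits are those of a cell inside the shifted interval, then the point is good. -/
lemma digit_point (q : ℕ) (hq : 0 < q) (δ : ℕ → ℕ) (hδ : ∀ j, δ j < q) (N m : ℕ) (h : N ≤ m)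
    (v : ℕ) (hv : ∀ j < N, δ j = (v / q ^ (N - 1 - j)) % q) (l r σ : ℝ) (hl : 0 ≤ l) (hr : r ≤ 1)
    (h1 : (l + σ) * (q:ℝ) ^ N < v) (h2 : (v:ℝ) + 1 ≤ (r + σ) * (q:ℝ) ^ N) :
    Int.fract (∑ j ∈ range m, (δ j : ℝ) / (q:ℝ) ^ (j + 1) - σ) ∈ Set.Ioo l r := by
  have hq' : (0:ℝ) < q := by positivity
  obtain ⟨t1, t2⟩ := digit_tail q hq δ hδ N m h
  set φ := ∑ j ∈ range m, (δ j : ℝ) / (q:ℝ) ^ (j + 1)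
  have e : ∑ j ∈ range N, (δ j : ℝ) / (q:ℝ) ^ (j + 1) = ((v % q ^ N : ℕ) : ℝ) / (q:ℝ) ^ N := by
    rw [← digit_sum q hq]
    apply sum_congr rfl
    intro j hj
    rw [hv j (mem_range.1 hj)]
  rw [e] at t1 t2
  have hp : (0:ℝ) < 1 / (q:ℝ) ^ m := by positivity
  have hN : (0:ℝ) < (q:ℝ) ^ N := by positivity
  have hmod : ((v % q ^ N : ℕ) : ℝ) / (q:ℝ) ^ N = v / (q:ℝ) ^ N - ((v / q ^ N : ℕ) : ℝ) := by
    have : ((q ^ N * (v / q ^ N) + v % q ^ N : ℕ) : ℝ) = v := by rw [Nat.div_add_mod]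
    push_cast at this
    field_simp
    linarith
  rw [hmod] at t1 t2
  have h1' : l + σ < v / (q:ℝ) ^ N := by rwa [lt_div_iff₀ hN]
  have h2' : v / (q:ℝ) ^ N + 1 / (q:ℝ) ^ N ≤ r + σ := by rwa [← add_div, div_le_iff₀ hN]
  have : Int.fract (φ - σ) = φ - σ + ((v / q ^ N : ℕ) : ℝ) := by
    rw [Int.fract_eq_iff]
    refine ⟨by linarith, by linarith, -((v / q ^ N : ℕ) : ℤ), ?_⟩
    rw [Int.cast_neg, Int.cast_natCast]; ring
  rw [this]
  constructor <;> linarith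

lemma exists_scale (q K : ℕ) (hq : 1 < q) (hK : 1 ≤ K) (x : ℝ) (h0 : 0 < x) (h1 : x ≤ 1) :
    ∃ k : ℕ, x * (q:ℝ) ^ k ≤ 1 ∧ (k = 0 ∨ x * (q:ℝ) ^ k * K ≤ 1) ∧ 1 < x * (q:ℝ) ^ (k + 1) * K := by
  classical
  have hK' : (1:ℝ) ≤ K := by exact_mod_cast hK
  have hex : ∃ k : ℕ, 1 < x * (q:ℝ) ^ (k + 1) * K := by
    obtain ⟨k, hk⟩ := pow_unbounded_of_one_lt (1 / x) (show (1:ℝ) < q by exact_mod_cast hq)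
    refine ⟨k, ?_⟩
    rw [div_lt_iff₀ h0] at hk
    have h3 : (q:ℝ) ^ k ≤ (q:ℝ) ^ (k + 1) :=
      pow_le_pow_right₀ (by exact_mod_cast hq.le) (by omega)
    have h4 : 1 < x * (q:ℝ) ^ (k + 1) := by nlinarith
    nlinarith
  refine ⟨Nat.find hex, ?_, ?_, Nat.find_spec hex⟩
  · rcases Nat.eq_zero_or_pos (Nat.find hex) with h | h
    · rw [h]; simpa using h1
    · have := Nat.find_min hex (show Nat.find hex - 1 < Nat.find hex by omega)
      rw [Nat.sub_add_cancel h, not_lt] at this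
      have : 0 ≤ x * (q:ℝ) ^ (Nat.find hex) := by positivity
      nlinarith
  · rcases Nat.eq_zero_or_pos (Nat.find hex) with h | h
    · left; exact h
    · right
      have := Nat.find_min hex (show Nat.find hex - 1 < Nat.find hex by omega)
      rwa [Nat.sub_add_cancel h, not_lt] at this

lemma good_shift (d q : ℕ) (hq : 0 < q) (hc : Nat.Coprime (d + 1) q) (l r : Fin d → ℝ) (k : Fin d → ℕ)
    (hk : ∀ i, k i = 0 ∨ (r i - l i) * (q:ℝ) ^ k i * (d + 1 : ℕ) ≤ 1) :
    ∃ s : Fin (d + 1), ∀ i, k i ≠ 0 → ∀ u : ℤ,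
      ¬ (l i + (s : ℕ) / ((d + 1 : ℕ) : ℝ) < u / (q:ℝ) ^ k i ∧
        u / (q:ℝ) ^ k i < r i + (s : ℕ) / ((d + 1 : ℕ) : ℝ)) := by
  by_contra hcon
  push Not at hcon
  choose i hi u hu using hcon
  obtain ⟨s, s', hne, hss⟩ : ∃ s s', s ≠ s' ∧ i s = i s' := by
    have := Fintype.exists_ne_map_eq_of_card_lt i (by simp)
    exact this
  have k1 := (hk (i s)).resolve_left (hi s)
  obtain ⟨a1, a2⟩ := hu s
  obtain ⟨b1, b2⟩ := hu s'
  rw [← hss] at b1 b2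
  set κ := k (i s)
  have hqk : (0:ℝ) < (q:ℝ) ^ κ := by positivity
  have hd : (0:ℝ) < ((d + 1 : ℕ) : ℝ) := by positivity
  set W : ℤ := (d + 1 : ℕ) * (u s - u s') - (q:ℤ) ^ κ * (((s : ℕ) : ℤ) - ((s' : ℕ) : ℤ)) with hW
  have hW0 : W ≠ 0 := by
    intro h0
    have h1 : ((d + 1 : ℕ) : ℤ) ∣ (q:ℤ) ^ κ * (((s : ℕ) : ℤ) - ((s' : ℕ) : ℤ)) :=
      ⟨u s - u s', by linarith⟩
    have h2 : IsCoprime ((d + 1 : ℕ) : ℤ) ((q:ℤ) ^ κ) :=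
      IsCoprime.pow_right (Nat.isCoprime_iff_coprime.2 hc)
    have h3 := h2.dvd_of_dvd_mul_left h1
    have h4 := Int.eq_zero_of_abs_lt_dvd h3 (by
      rw [abs_lt]; have := s.2; have := s'.2; constructor <;> omega)
    exact hne (Fin.ext (by omega))
  have hWr : (1:ℝ) ≤ |(W:ℝ)| := by
    have := Int.one_le_abs hW0
    exact_mod_cast this
  have e : (W:ℝ) = ((u s / (q:ℝ) ^ κ - (s:ℕ) / ((d + 1 : ℕ) : ℝ)) - (u s' / (q:ℝ) ^ κ - (s':ℕ) / ((d + 1 : ℕ) : ℝ)))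
      * ((q:ℝ) ^ κ * (d + 1 : ℕ)) := by
    rw [hW]; push_cast; push_cast at hd; field_simp; ring
  rw [e, abs_mul, abs_of_pos (mul_pos hqk hd)] at hWr
  have : |((u s / (q:ℝ) ^ κ - (s:ℕ) / ((d + 1 : ℕ) : ℝ)) - (u s' / (q:ℝ) ^ κ - (s':ℕ) / ((d + 1 : ℕ) : ℝ)))|
      < r (i s) - l (i s) := by
    rw [abs_lt]; constructor <;> linarith
  have := mul_lt_mul_of_pos_right this (mul_pos hqk hd)
  nlinarith

lemma interval (q : ℕ) (hq : 0 < q) (l r σ : ℝ) (hl : 0 ≤ l) (hσ : 0 ≤ σ) (k : ℕ)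
    (h2 : 2 ≤ (r - l) * (q:ℝ) ^ (k + 4))
    (h1 : (r - l) * (q:ℝ) ^ k ≤ 1)
    (hs : k ≠ 0 → ∀ u : ℤ, ¬ (l + σ < u / (q:ℝ) ^ k ∧ u / (q:ℝ) ^ k < r + σ)) :
    ∃ v B G : ℕ, B ≤ q ^ 4 ∧ (r - l) * (q:ℝ) ^ (k + 4) - 2 ≤ B ∧
      ∀ t < B, (l + σ) * (q:ℝ) ^ (k + 4) < ((v + t : ℕ) : ℝ) ∧
        ((v + t : ℕ) : ℝ) + 1 ≤ (r + σ) * (q:ℝ) ^ (k + 4) ∧ (k ≠ 0 → (v + t) / q ^ 4 = G) := by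
  have hq' : (0:ℝ) < q := by positivity
  have hL0 : 0 ≤ (l + σ) * (q:ℝ) ^ (k + 4) := by positivity
  set L := (l + σ) * (q:ℝ) ^ (k + 4) with hL
  set R := (r + σ) * (q:ℝ) ^ (k + 4) with hR
  have hLR : R - L = (r - l) * (q:ℝ) ^ (k + 4) := by rw [hL, hR]; ring
  rw [← hLR] at h2 ⊢
  have hup : R - L ≤ (q:ℝ) ^ 4 := by
    rw [hLR, pow_add, ← mul_assoc]
    have : (0:ℝ) < (q:ℝ) ^ 4 := by positivity
    nlinarith
  have hR1 : 0 ≤ R - 1 := by linarith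
  have f1 := Nat.floor_le hL0
  have f2 := Nat.lt_floor_add_one L
  have g1 := Nat.floor_le hR1
  have g2 := Nat.lt_floor_add_one (R - 1)
  have hle : ⌊L⌋₊ ≤ ⌊R - 1⌋₊ := Nat.floor_le_floor (by linarith)
  refine ⟨⌊L⌋₊ + 1, ⌊R - 1⌋₊ - ⌊L⌋₊, ⌊L⌋₊ / q ^ 4, ?_, ?_, ?_⟩
  · have : ((⌊R - 1⌋₊ - ⌊L⌋₊ : ℕ) : ℝ) ≤ ((q ^ 4 : ℕ) : ℝ) := by
      rw [Nat.cast_sub hle]; push_cast; linarith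
    exact_mod_cast this
  · rw [Nat.cast_sub hle]; linarith
  · intro t ht
    have ht' : ⌊L⌋₊ + 1 + t ≤ ⌊R - 1⌋₊ := by omega
    have ht2 : ((⌊L⌋₊ + 1 + t : ℕ) : ℝ) ≤ (⌊R - 1⌋₊ : ℝ) := by exact_mod_cast ht'
    refine ⟨?_, by linarith, ?_⟩
    · push_cast
      have : (0:ℝ) ≤ t := by positivity
      linarith
    · intro hk
      by_contra hne
      have hlt : ⌊L⌋₊ / q ^ 4 < (⌊L⌋₊ + 1 + t) / q ^ 4 :=
        lt_of_le_of_ne (Nat.div_le_div_right (by omega)) (Ne.symm hne)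
      set u := (⌊L⌋₊ + 1 + t) / q ^ 4 with hu
      have u1 : u * q ^ 4 ≤ ⌊L⌋₊ + 1 + t := Nat.div_mul_le_self _ _
      have u2 : ⌊L⌋₊ < u * q ^ 4 := (Nat.div_lt_iff_lt_mul (by positivity)).1 hlt
      apply hs hk u
      have u1' : ((u * q ^ 4 : ℕ) : ℝ) ≤ ((⌊L⌋₊ + 1 + t : ℕ) : ℝ) := by exact_mod_cast u1
      have u2' : ((⌊L⌋₊ + 1 : ℕ) : ℝ) ≤ ((u * q ^ 4 : ℕ) : ℝ) := by exact_mod_cast u2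
      push_cast at u1' u2' ht2
      have hk0 : (0:ℝ) < (q:ℝ) ^ k := by positivity
      have hk4 : (0:ℝ) < (q:ℝ) ^ 4 := by positivity
      rw [lt_div_iff₀ hk0, div_lt_iff₀ hk0]
      have e1 : L = (l + σ) * (q:ℝ) ^ k * (q:ℝ) ^ 4 := by rw [hL, pow_add]; ring
      have e2 : R = (r + σ) * (q:ℝ) ^ k * (q:ℝ) ^ 4 := by rw [hR, pow_add]; ring
      constructor
      · apply lt_of_mul_lt_mul_right _ hk4.le
        rw [← e1]; push_cast; linarith
      · apply lt_of_mul_lt_mul_right _ hk4.le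
        rw [← e2]; push_cast; linarith

end Disp

namespace Disp

open Polynomial

/-- Four base-`q` digits of `v`, most significant first. -/
def dig (q v : ℕ) : Fin 4 → ZMod q := fun j => ((v / q ^ (3 - (j : ℕ)) : ℕ) : ZMod q)

/-- Digit vectors of an interval of integers. -/
def digset (q A B : ℕ) : Finset (Fin 4 → ZMod q) := (range B).image (fun t => dig q (A + t))

lemma dig_inj (q : ℕ) (hq : 0 < q) (v v' : ℕ) (h : dig q v = dig q v') : v % q ^ 4 = v' % q ^ 4 := by
  have h1 := digit_sum q hq 4 v
  have h2 := digit_sum q hq 4 v'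
  have h3 : ∑ j ∈ range 4, (((v / q ^ (4 - 1 - j)) % q : ℕ) : ℝ) / (q:ℝ) ^ (j + 1)
    = ∑ j ∈ range 4, (((v' / q ^ (4 - 1 - j)) % q : ℕ) : ℝ) / (q:ℝ) ^ (j + 1) := by
    apply sum_congr rfl
    intro j hj
    have := congrFun h ⟨j, mem_range.1 hj⟩
    simp only [dig] at this
    rw [ZMod.natCast_eq_natCast_iff] at this
    rw [show 4 - 1 - j = 3 - j by omega, this]
  rw [h1, h2] at h3
  have hq' : (q:ℝ) ≠ 0 := by positivity
  field_simp at h3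
  exact_mod_cast h3

lemma card_digset (q A B : ℕ) (hq : 0 < q) (hB : B ≤ q ^ 4) : (digset q A B).card = B := by
  rw [digset, card_image_of_injOn, card_range]
  intro t ht t' ht' h
  have := dig_inj q hq _ _ h
  have h2 : t ≡ t' [MOD q ^ 4] := Nat.ModEq.add_left_cancel' A this
  simp at ht ht'
  exact h2.eq_of_lt_of_lt (by omega) (by omega)

lemma dig_mod (q v t : ℕ) (hq : 0 < q) : dig q (v % q ^ 4 + t) = dig q (v + t) := by
  funext j
  simp only [dig]
  have e : v + t = (v % q ^ 4 + t) + q ^ (3 - (j:ℕ)) * (q * (q ^ (j:ℕ) * (v / q ^ 4))) := by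
    have h1 := Nat.div_add_mod v (q ^ 4)
    have h2 : q ^ (3 - (j:ℕ)) * (q * (q ^ (j:ℕ) * (v / q ^ 4))) = q ^ 4 * (v / q ^ 4) := by
      rw [← mul_assoc, ← mul_assoc, ← pow_succ, ← pow_add]
      congr 2
      have := j.2
      omega
    rw [h2]; omega
  rw [e, Nat.add_mul_div_left _ _ (by positivity)]
  push_cast
  simp

lemma digset_mod (q A B : ℕ) (hq : 0 < q) : digset q (A % q ^ 4) B = digset q A B := by
  simp only [digset, dig_mod q A _ hq]

lemma coeff_mul_congr {F : Type*} [Field F] (P P' T : F[X]) (n : ℕ) (h : ∀ j : Fin n, P.coeff j = P'.coeff j) (j : Fin n) :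
    (P * T).coeff j = (P' * T).coeff j := by
  rw [coeff_mul, coeff_mul]
  apply sum_congr rfl
  intro x hx
  have := mem_antidiagonal.1 hx
  have h2 := h ⟨x.1, by omega⟩
  simp only at h2
  rw [h2]

section
variable {F : Type*} [Field F] [Fintype F] [DecidableEq F]

/-- The residues of the polynomials that fall into a box. -/
noncomputable def fam {d : ℕ} (a : Fin d → F) (e n0 : ℕ) (G : Fin e → F) (M : F[X])
    (h : Fin d → Fin 4 → F) (P : Fin d → F[X]) (D : Fin d → Finset (Fin 4 → F)) :
    Finset (Fin e → F) :=
  (univ.filter (fun c : Fin n0 → F =>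
    ∀ i, (fun j : Fin 4 => h i j + (P i * taylor (a i) (pol n0 c)).coeff j) ∈ D i)).image
    (fun c j => G j + (M * pol n0 c).coeff j)

lemma fam_card {d : ℕ} (a : Fin d → F) (ha : Function.Injective a) (e n0 : ℕ) (G : Fin e → F) (M : F[X])
    (h : Fin d → Fin 4 → F) (P : Fin d → F[X]) (D : Fin d → Finset (Fin 4 → F))
    (hP : ∀ i, (P i).coeff 0 ≠ 0) (hM : M.coeff 0 ≠ 0) (h1 : 4 * d ≤ n0) (h2 : n0 ≤ e) :
    (fam a e n0 G M h P D).card = (∏ i, (D i).card) * Fintype.card F ^ (n0 - 4 * d) := by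
  rw [fam, card_image_of_injective, count a ha n0 h1 P hP h D]
  intro c c' hc
  rw [← sub_eq_zero]
  apply pol_eq_zero
  have h3 : X ^ e ∣ M * pol n0 (c - c') := by
    rw [X_pow_dvd_iff]
    intro j hj
    have := congrFun hc ⟨j, hj⟩
    simp only [add_right_inj] at this
    simp [pol_sub, mul_sub, this]
  have h4 : X ^ e ∣ pol n0 (c - c') := by
    refine IsCoprime.dvd_of_dvd_mul_left ?_ h3
    apply IsCoprime.pow_left
    rw [Polynomial.prime_X.coprime_iff_not_dvd, X_dvd_iff]
    exact hM
  rw [X_pow_dvd_iff] at h4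
  ext j
  by_cases hj : j < e
  · simpa using h4 j hj
  · simpa using pol_coeff_ge _ _ _ (by omega)

lemma fam_congr {d : ℕ} (a : Fin d → F) (e n0 : ℕ) (G : Fin e → F) (M M' : F[X])
    (h : Fin d → Fin 4 → F) (P P' : Fin d → F[X]) (D : Fin d → Finset (Fin 4 → F))
    (hM : ∀ j : Fin e, M.coeff j = M'.coeff j) (hP : ∀ i, ∀ j : Fin 4, (P i).coeff j = (P' i).coeff j) :
    fam a e n0 G M h P D = fam a e n0 G M' h P' D := by
  have h1 : ∀ (i : Fin d) (T : F[X]) (j : Fin 4), (P i * T).coeff j = (P' i * T).coeff j :=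
    fun i T j => coeff_mul_congr (P i) (P' i) T 4 (hP i) j
  simp only [fam, coeff_mul_congr M M' _ e hM, h1]

end

lemma hit_family (q : ℕ) [Fact q.Prime] {d : ℕ} (a : Fin d → ZMod q) (e N : ℕ) (T : ℝ)
    (hT : (((e + 1) * q ^ e * q ^ e * q ^ (4 * d) * q ^ (4 * d) * q ^ (4 * d) * (q ^ 4 + 1) ^ d : ℕ) : ℝ)
      < Real.exp T) :
    ∃ α : Fin N → (Fin e → ZMod q), ∀ (n0 : ℕ) (G : Fin e → ZMod q) (M : (ZMod q)[X])
      (h : Fin d → Fin 4 → ZMod q) (P : Fin d → (ZMod q)[X]) (A B : Fin d → ℕ), n0 ≤ e →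
      (∀ i, B i ≤ q ^ 4) →
      T * (q:ℝ) ^ e ≤ (fam a e n0 G M h P (fun i => digset q (A i) (B i))).card * N →
      ∃ t, α t ∈ fam a e n0 G M h P (fun i => digset q (A i) (B i)) := by
  have hq : 0 < q := (Fact.out : q.Prime).pos
  let ι := Fin (e + 1) × (Fin e → ZMod q) × (ZMod q)[X] × (Fin d → Fin 4 → ZMod q) ×
    (Fin d → (ZMod q)[X]) × (Fin d → Fin (q ^ 4)) × (Fin d → Fin (q ^ 4 + 1))
  let Λ := Fin (e + 1) × (Fin e → ZMod q) × (Fin e → ZMod q) × (Fin d → Fin 4 → ZMod q) ×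
    (Fin d → Fin 4 → ZMod q) × (Fin d → Fin (q ^ 4)) × (Fin d → Fin (q ^ 4 + 1))
  let S : ι → Finset (Fin e → ZMod q) := fun ⟨n0, G, M, h, P, A, B⟩ =>
    fam a e n0 G M h P (fun i => digset q (A i) (B i))
  let key : ι → Λ := fun ⟨n0, G, M, h, P, A, B⟩ =>
    ⟨n0, G, fun j => M.coeff j, h, fun i j => (P i).coeff j, A, B⟩
  have hkey : ∀ i i', key i = key i' → S i = S i' := by
    rintro ⟨n0, G, M, h, P, A, B⟩ ⟨n0', G', M', h', P', A', B'⟩ hk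
    simp only [key, Λ, Prod.mk.injEq] at hk
    obtain ⟨rfl, rfl, hM, rfl, hP, rfl, rfl⟩ := hk
    exact fam_congr a e n0 G M M' h P P' _ (fun j => congrFun hM j)
      (fun i j => congrFun (congrFun hP i) j)
  have hcard : Fintype.card Λ = (e + 1) * q ^ e * q ^ e * q ^ (4 * d) * q ^ (4 * d) * q ^ (4 * d) * (q ^ 4 + 1) ^ d := by
    simp only [Λ, Fintype.card_prod, Fintype.card_pi, Fintype.card_fin, ZMod.card, prod_const, card_univ]
    rw [← pow_mul]; ring
  obtain ⟨α, hα⟩ := hitting S key hkey N T (by simp; positivity) (by rw [hcard]; exact hT)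
  refine ⟨α, fun n0 G M h P A B hn hB hbig => ?_⟩
  have := hα ⟨⟨n0, by omega⟩, G, M, h, P, fun i => ⟨A i % q ^ 4, Nat.mod_lt _ (by positivity)⟩,
    fun i => ⟨B i, by have := hB i; omega⟩⟩
  simp only [S, digset_mod _ _ _ hq] at this
  apply this
  simpa using hbig

/-- The point of the construction attached to a polynomial `x` and a shift `s`. -/
noncomputable def pt (q : ℕ) {d : ℕ} (a : Fin d → ZMod q) (m : ℕ) (s : ℕ) (x : (ZMod q)[X]) :
    Fin d → ℝ := fun i =>
  Int.fract (∑ j ∈ range m, (((taylor (a i) x).coeff j).val : ℝ) / (q:ℝ) ^ (j + 1)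
    - (s:ℝ) / ((d + 1 : ℕ) : ℝ))

lemma box_hit (q : ℕ) [Fact q.Prime] {d : ℕ} (hqd : Nat.Coprime (d + 1) q)
    (a : Fin d → ZMod q) (ha : Function.Injective a) (ha0 : ∀ i, a i ≠ 0)
    (e rr N : ℕ) (T : ℝ) (α : Fin N → (Fin e → ZMod q))
    (hα : ∀ (n0 : ℕ) (G : Fin e → ZMod q) (M : (ZMod q)[X])
      (h : Fin d → Fin 4 → ZMod q) (P : Fin d → (ZMod q)[X]) (A B : Fin d → ℕ), n0 ≤ e →
      (∀ i, B i ≤ q ^ 4) →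
      T * (q:ℝ) ^ e ≤ (fam a e n0 G M h P (fun i => digset q (A i) (B i))).card * N →
      ∃ t, α t ∈ fam a e n0 G M h P (fun i => digset q (A i) (B i)))
    (l r : Fin d → ℝ) (hl : ∀ i, 0 ≤ l i) (hr : ∀ i, r i ≤ 1) (k : Fin d → ℕ)
    (hk1 : ∀ i, (r i - l i) * (q:ℝ) ^ k i ≤ 1)
    (hk2 : ∀ i, k i = 0 ∨ (r i - l i) * (q:ℝ) ^ k i * (d + 1 : ℕ) ≤ 1)
    (hk3 : ∀ i, 2 ≤ (r i - l i) * (q:ℝ) ^ (k i + 4))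
    (n0 : ℕ) (hn0 : 4 * d ≤ n0) (hn0' : n0 ≤ e) (hm : ∑ i, k i + n0 ≤ e + rr)
    (hbig : T * (q:ℝ) ^ e ≤ (∏ i, ((r i - l i) * (q:ℝ) ^ (k i + 4) - 2)) * (q:ℝ) ^ (n0 - 4 * d) * N) :
    ∃ (s : Fin (d + 1)) (t : Fin N) (w : Fin rr → ZMod q), ∀ i,
      pt q a (e + rr) s (pol e (α t) + X ^ e * pol rr w) i ∈ Set.Ioo (l i) (r i) := by
  have hq : 0 < q := (Fact.out : q.Prime).pos
  obtain ⟨s, hs⟩ := good_shift d q hq hqd l r k hk2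
  have hσ : (0:ℝ) ≤ (s : ℕ) / ((d + 1 : ℕ) : ℝ) := by positivity
  choose v B G hB hB2 hv using fun i => interval q hq (l i) (r i) _ (hl i) hσ (k i) (hk3 i) (hk1 i) (hs i)
  obtain ⟨g, hg, hg2⟩ := crt_surj a ha k (fun i j => ((G i / q ^ (k i - 1 - j) : ℕ) : ZMod q))
  set M : (ZMod q)[X] := ∏ i, (X - C (a i)) ^ k i with hM
  have hMm : M.degree = (∑ i, k i : ℕ) := by
    rw [hM, degree_prod]; simp
  let P : Fin d → (ZMod q)[X] := fun i => taylor (a i) (∏ j ∈ univ.erase i, (X - C (a j)) ^ k j)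
  have hMP : ∀ i, taylor (a i) M = X ^ k i * P i := by
    intro i
    simp only [P]
    rw [hM, ← mul_prod_erase univ _ (mem_univ i), taylor_mul, taylor_pow]
    simp
  have hP0 : ∀ i, (P i).coeff 0 ≠ 0 := by
    intro i
    simp only [P, taylor_coeff_zero, eval_prod, prod_ne_zero_iff]
    intro j hj
    simp only [eval_pow, eval_sub, eval_X, eval_C]
    exact pow_ne_zero _ (sub_ne_zero.2 fun h => (mem_erase.1 hj).1 (ha h).symm)
  have hM0 : M.coeff 0 ≠ 0 := by
    rw [coeff_zero_eq_eval_zero, hM, eval_prod, prod_ne_zero_iff]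
    intro j _
    simp only [eval_pow, eval_sub, eval_X, eval_C]
    exact pow_ne_zero _ (by simpa using ha0 j)
  let h : Fin d → Fin 4 → ZMod q := fun i j => (taylor (a i) g).coeff (k i + j)
  obtain ⟨t, ht⟩ := hα n0 (fun j => g.coeff j) M h P v B hn0' hB (by
    rw [fam_card a ha e n0 _ _ _ _ _ hP0 hM0 hn0 hn0']
    refine hbig.trans ?_
    push_cast
    simp only [card_digset q _ _ hq (hB _), ZMod.card]
    gcongr with i
    · intro i _; linarith [hk3 i]
    · exact hB2 i)
  simp only [fam, mem_image, mem_filter, mem_univ, true_and] at ht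
  obtain ⟨c, hc, hct⟩ := ht
  set x : (ZMod q)[X] := g + M * pol n0 c with hx
  have hxdeg : x.degree < ((e + rr : ℕ) : WithBot ℕ) := by
    have hle : ((∑ i, k i + n0 : ℕ) : WithBot ℕ) ≤ ((e + rr : ℕ) : WithBot ℕ) := by exact_mod_cast hm
    refine lt_of_lt_of_le ?_ hle
    refine (degree_add_le _ _).trans_lt (max_lt (hg.trans_le ?_) ?_)
    · exact_mod_cast Nat.le_add_right _ _
    · rw [degree_mul, hMm]
      by_cases h0 : pol n0 c = 0
      · rw [h0, degree_zero, WithBot.add_bot]; exact WithBot.bot_lt_coe _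
      · have := pol_degree n0 c
        rw [degree_eq_natDegree h0] at this ⊢
        have h5 : (pol n0 c).natDegree < n0 := by exact_mod_cast this
        exact_mod_cast Nat.add_lt_add_left h5 _
  refine ⟨s, t, fun j => x.coeff (e + j), ?_⟩
  have hxe : pol e (α t) + X ^ e * pol rr (fun j : Fin rr => x.coeff (e + j)) = x := by
    ext j
    rw [coeff_add, coeff_X_pow_mul']
    by_cases hj : j < e
    · rw [if_neg (by omega), add_zero, show j = ((⟨j, hj⟩ : Fin e) : ℕ) from rfl, pol_coeff, ← hct]
      simp [hx]
    · rw [if_pos (by omega), pol_coeff_ge _ _ _ (by omega), zero_add]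
      by_cases hj2 : j - e < rr
      · rw [show j - e = ((⟨j - e, hj2⟩ : Fin rr) : ℕ) from rfl, pol_coeff]
        congr 1; simp; omega
      · rw [pol_coeff_ge _ _ _ (by omega), coeff_eq_zero_of_degree_lt (hxdeg.trans_le _)]
        exact_mod_cast (by omega : e + rr ≤ j)
  rw [hxe]
  intro i
  have hki : k i ≤ ∑ i, k i := single_le_sum (f := k) (fun _ _ => Nat.zero_le _) (mem_univ i)
  have hd1 : 1 ≤ d := Fin.pos i
  have hci := hc i
  simp only [digset, mem_image, mem_range] at hci
  obtain ⟨τ, hτ, hdig⟩ := hci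
  obtain ⟨v1, v2, v3⟩ := hv i τ hτ
  have htx : taylor (a i) x = taylor (a i) g + X ^ k i * (P i * taylor (a i) (pol n0 c)) := by
    rw [hx, map_add, taylor_mul, hMP, mul_assoc]
  refine digit_point q hq (fun j => ((taylor (a i) x).coeff j).val) (fun j => ZMod.val_lt _)
    (k i + 4) (e + rr) (by omega) (v i + τ) ?_ (l i) (r i) _ (hl i) (hr i) v1 v2
  intro j hj
  rw [← ZMod.val_natCast]
  congr 1
  rw [htx, coeff_add, coeff_X_pow_mul']
  by_cases hjk : j < k i
  · rw [if_neg (by omega), add_zero, hg2 i j hjk, ← v3 (by omega), Nat.div_div_eq_div_mul, ← pow_add]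
    congr 3; omega
  · rw [if_pos (by omega)]
    have := congrFun hdig ⟨j - k i, by omega⟩
    simp only [dig, h] at this
    rw [show k i + (j - k i) = j by omega] at this
    rw [← this]
    congr 3; omega

end Disp


namespace Disp

lemma key_count (d q : ℕ) (hd : 3 ≤ d) (hq : d + 2 ≤ q) (hq2 : q ≤ d ^ 2) :
    (((10 * d + 1) * q ^ (10 * d) * q ^ (10 * d) * q ^ (4 * d) * q ^ (4 * d) * q ^ (4 * d)
      * (q ^ 4 + 1) ^ d : ℕ) : ℝ) < Real.exp (77 * d * Real.log d) := by
  have h1 : 10 * d + 1 ≤ q ^ d := by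
    calc 10 * d + 1 ≤ (d + 2) ^ 3 := by nlinarith
      _ ≤ q ^ 3 := Nat.pow_le_pow_left hq 3
      _ ≤ q ^ d := Nat.pow_le_pow_right (by omega) hd
  have h2 : (q ^ 4 + 1) ^ d ≤ q ^ (5 * d) := by
    rw [pow_mul]
    apply Nat.pow_le_pow_left
    have : 1 ≤ q ^ 4 := Nat.one_le_pow _ _ (by omega)
    rw [pow_succ q 4]; nlinarith
  have h3 : (10 * d + 1) * q ^ (10 * d) * q ^ (10 * d) * q ^ (4 * d) * q ^ (4 * d) * q ^ (4 * d)
      * (q ^ 4 + 1) ^ d ≤ d ^ (76 * d) := by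
    calc _ ≤ q ^ d * q ^ (10 * d) * q ^ (10 * d) * q ^ (4 * d) * q ^ (4 * d) * q ^ (4 * d) * q ^ (5 * d) := by
          gcongr
      _ = q ^ (38 * d) := by simp only [← pow_add]; congr 1; ring
      _ ≤ (d ^ 2) ^ (38 * d) := Nat.pow_le_pow_left hq2 _
      _ = d ^ (76 * d) := by rw [← pow_mul]; congr 1; ring
  have hd0 : (0:ℝ) < d := by positivity
  have hl : 0 < Real.log d := Real.log_pos (by exact_mod_cast (by omega : 1 < d))
  calc _ ≤ ((d ^ (76 * d) : ℕ) : ℝ) := by exact_mod_cast h3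
    _ = Real.exp (76 * d * Real.log d) := by
      push_cast
      conv_lhs => rw [← Real.exp_log hd0]
      rw [← Real.exp_nat_mul]
      push_cast; ring_nf
    _ < _ := by
      apply Real.exp_lt_exp.2
      nlinarith [mul_pos hd0 hl]

lemma prod_bound (d q : ℕ) (hd : 3 ≤ d) (hq : d + 2 ≤ q) (y : Fin d → ℝ) 
    (hy : ∀ i, 1 ≤ y i * (q:ℝ) ^ 2) :
    1 / 2 * (∏ i, y i) * (q:ℝ) ^ (4 * d) ≤ ∏ i, (y i * (q:ℝ) ^ 4 - 2) := by
  have hq0 : (0:ℝ) < q := by exact_mod_cast (by omega : 0 < q)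
  have hqd : (d:ℝ) + 2 ≤ q := by exact_mod_cast hq
  have hd' : (3:ℝ) ≤ d := by exact_mod_cast hd
  have hy0 : ∀ i, 0 < y i := fun i => by
    by_contra h
    have := hy i
    have : (0:ℝ) < (q:ℝ) ^ 2 := by positivity
    nlinarith
  set z : ℝ := 2 / (q:ℝ) ^ 2 with hz
  have hzq : z * (q:ℝ) ^ 2 = 2 := by rw [hz]; field_simp
  have hz1 : z * d ≤ 1 / 2 := by
    rw [hz, div_mul_eq_mul_div, div_le_iff₀ (by positivity)]; nlinarith
  have hz0 : 0 ≤ z := by positivity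
  have hz2 : z ≤ 1 := by nlinarith
  have b := one_add_mul_le_pow (show (-2:ℝ) ≤ -z by linarith) d
  have hyp : 0 ≤ ∏ i, y i := prod_nonneg fun i _ => (hy0 i).le
  calc 1 / 2 * (∏ i, y i) * (q:ℝ) ^ (4 * d) = (∏ i, y i) * (q:ℝ) ^ (4 * d) * (1 / 2) := by ring
    _ ≤ (∏ i, y i) * (q:ℝ) ^ (4 * d) * (1 + -z) ^ d := by
      gcongr; linarith
    _ = ∏ i, (y i * (q:ℝ) ^ 4 * (1 + -z)) := by
      rw [prod_mul_distrib, prod_mul_distrib]; simp [pow_mul]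
    _ ≤ _ := by
      apply prod_le_prod
      · intro i _
        have := hy0 i
        have : 0 ≤ 1 + -z := by linarith
        positivity
      · intro i _
        have e : y i * (q:ℝ) ^ 4 * (1 + -z) = y i * (q:ℝ) ^ 4 - (y i * (q:ℝ) ^ 2) * (z * (q:ℝ) ^ 2) := by ring
        rw [e, hzq]; linarith [hy i]

lemma prod_mul_sq (d q : ℕ) (y : Fin d → ℝ) :
    (∏ i, y i) * (q:ℝ) ^ (2 * d) = ∏ i, (y i * (q:ℝ) ^ 2) := by
  rw [Finset.prod_mul_distrib, Finset.prod_const, Finset.card_univ, Fintype.card_fin, ← pow_mul]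

end Disp

open Disp

set_option maxHeartbeats 2000000 in
/-- For every `d ≥ 3` and `n ≥ 1` there is a set of at most `n` points in `[0,1]^d` meeting
every open axis-parallel box of volume greater than `8000·d²·log d / n`. -/
theorem stmt_17 (d n : ℕ) (hd : 3 ≤ d) (hn : 1 ≤ n) :
    ∃ P : Finset (Fin d → ℝ), P.card ≤ n ∧
      (∀ p ∈ P, ∀ i, p i ∈ Set.Icc (0:ℝ) 1) ∧
      ∀ a b : Fin d → ℝ, (∀ i, 0 ≤ a i ∧ a i < b i ∧ b i ≤ 1) →
        8000 * (d:ℝ)^2 * Real.log d / n < ∏ i, (b i - a i) →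
        ∃ p ∈ P, ∀ i, p i ∈ Set.Ioo (a i) (b i) := by
  classical
  have hn0 : (0:ℝ) < n := by exact_mod_cast hn
  have hd3 : (3:ℝ) ≤ d := by exact_mod_cast hd
  have hlog : 1 ≤ Real.log d := by
    rw [Real.le_log_iff_exp_le (by linarith)]
    linarith [Real.exp_one_lt_d9]
  have hlogd : Real.log d ≤ d := (Real.log_le_sub_one_of_pos (by linarith)).trans (by linarith)
  rcases le_or_gt (n:ℝ) (8000 * (d:ℝ)^2 * Real.log d) with hsmall | hlarge
  · refine ⟨∅, by simp, by simp, fun a b hab hv => ?_⟩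
    exfalso
    have h1 : ∏ i, (b i - a i) ≤ 1 :=
      prod_le_one (fun i _ => by linarith [(hab i).2.1]) (fun i _ => by linarith [(hab i).1, (hab i).2.2])
    have h2 : 1 ≤ 8000 * (d:ℝ)^2 * Real.log d / n := by rwa [le_div_iff₀ hn0, one_mul]
    linarith
  obtain ⟨q, hqp, hq1, hq2⟩ := Nat.exists_prime_lt_and_le_two_mul (d + 1) (by omega)
  have : Fact q.Prime := ⟨hqp⟩
  have hqsq : q ≤ d ^ 2 := by nlinarith
  have hq0 : 0 < q := hqp.pos
  have hqr : (0:ℝ) < q := by exact_mod_cast hq0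
  have hq5 : (5:ℝ) ≤ q := by exact_mod_cast (by omega : 5 ≤ q)
  have hqd : (d:ℝ) + 2 ≤ q := by exact_mod_cast hq1
  have hcop : Nat.Coprime (d + 1) q :=
    ((Nat.Prime.coprime_iff_not_dvd hqp).2 (fun h => by
      have := Nat.le_of_dvd (by omega) h; omega)).symm
  let a : Fin d → ZMod q := fun i => (((i : ℕ) + 1 : ℕ) : ZMod q)
  have ha : Function.Injective a := by
    intro i j h
    simp only [a] at h
    rw [ZMod.natCast_eq_natCast_iff] at h
    have := h.eq_of_lt_of_lt (by omega) (by omega)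
    exact Fin.ext (by omega)
  have ha0 : ∀ i, a i ≠ 0 := by
    intro i h
    simp only [a] at h
    rw [ZMod.natCast_eq_zero_iff] at h
    have := Nat.le_of_dvd (by omega) h
    omega
  have hex : ∃ r : ℕ, n ≤ q ^ (6 * d + r) :=
    ⟨n, (Nat.lt_pow_self hqp.one_lt).le.trans (Nat.pow_le_pow_right hq0 (by omega))⟩
  obtain ⟨rr, hr1, hr2⟩ : ∃ rr : ℕ, n ≤ q ^ (6 * d + rr) ∧ (rr = 0 ∨ q ^ (6 * d + rr) < n * q) := by
    refine ⟨Nat.find hex, Nat.find_spec hex, ?_⟩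
    rcases Nat.eq_zero_or_pos (Nat.find hex) with h | h
    · left; exact h
    · right
      have := Nat.find_min hex (show Nat.find hex - 1 < Nat.find hex by omega)
      rw [not_le] at this
      have e : 6 * d + Nat.find hex = (6 * d + (Nat.find hex - 1)) + 1 := by omega
      rw [e, pow_succ]
      exact Nat.mul_lt_mul_of_pos_right this hq0
  have hDn : (d + 1) * q ^ rr ≤ n := by
    rcases hr2 with h | h
    · rw [h]
      have : ((d + 1 : ℕ) : ℝ) ≤ n := by
        push_cast
        nlinarith
      have : d + 1 ≤ n := by exact_mod_cast this
      simpa using this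
    · have h1 : (d + 1) * q ^ rr * q ≤ q ^ (6 * d + rr) := by
        calc (d + 1) * q ^ rr * q ≤ q * q ^ rr * q := by gcongr
          _ = q ^ (rr + 2) := by ring
          _ ≤ _ := Nat.pow_le_pow_right hq0 (by omega)
      exact Nat.le_of_mul_le_mul_right (h1.trans h.le) hq0
  set N := n / ((d + 1) * q ^ rr) with hN
  have hD0 : 0 < (d + 1) * q ^ rr := by positivity
  have hN1 : N * ((d + 1) * q ^ rr) ≤ n := Nat.div_mul_le_self _ _
  have hN2 : n ≤ 2 * N * ((d + 1) * q ^ rr) := by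
    have h1 : 1 ≤ N := (Nat.one_le_div_iff hD0).2 hDn
    have h2 : n < (N + 1) * ((d + 1) * q ^ rr) := by
      rw [hN, add_mul, one_mul]; exact Nat.lt_div_mul_add hD0
    nlinarith
  have hN2r : (n:ℝ) ≤ 2 * N * ((d + 1) * (q:ℝ) ^ rr) := by exact_mod_cast hN2
  obtain ⟨α, hα⟩ := hit_family q a (10 * d) N (77 * d * Real.log d) (key_count d q hd hq1 hqsq)
  refine ⟨(univ : Finset (Fin (d + 1) × Fin N × (Fin rr → ZMod q))).image (fun z =>
    pt q a (10 * d + rr) z.1 (pol (10 * d) (α z.2.1) + Polynomial.X ^ (10 * d) * pol rr z.2.2)), ?_, ?_, ?_⟩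
  · refine card_image_le.trans ?_
    simp only [card_univ, Fintype.card_prod, Fintype.card_fin, Fintype.card_pi, ZMod.card, prod_const]
    calc _ = N * ((d + 1) * q ^ rr) := by ring
      _ ≤ n := hN1
  · intro p hp i
    obtain ⟨z, _, rfl⟩ := mem_image.1 hp
    exact ⟨Int.fract_nonneg _, (Int.fract_lt_one _).le⟩
  intro l r hlr hvol
  rw [div_lt_iff₀ hn0] at hvol
  have hx0 : ∀ i, 0 < r i - l i := fun i => by linarith [(hlr i).2.1]
  have hx1 : ∀ i, r i - l i ≤ 1 := fun i => by linarith [(hlr i).1, (hlr i).2.2]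
  choose k hk1 hk2 hk3 using fun i =>
    exists_scale q (d + 1) hqp.one_lt (by omega) (r i - l i) (hx0 i) (hx1 i)
  set y : Fin d → ℝ := fun i => (r i - l i) * (q:ℝ) ^ k i with hy
  have hy0 : ∀ i, 0 < y i := fun i => by have := hx0 i; positivity
  have hy2 : ∀ i, 1 ≤ y i * (q:ℝ) ^ 2 := by
    intro i
    have h1 := hk3 i
    have e : (r i - l i) * (q:ℝ) ^ (k i + 1) * ((d + 1 : ℕ) : ℝ) = y i * q * (d + 1) := by
      rw [hy, pow_succ]; push_cast; ring
    rw [e] at h1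
    have : y i * q * (d + 1) ≤ y i * q * q := by
      have := hy0 i
      gcongr
      linarith
    nlinarith
  have e4 : ∀ i, (r i - l i) * (q:ℝ) ^ (k i + 4) = y i * (q:ℝ) ^ 4 := by
    intro i; rw [hy, pow_add]; ring
  have hpb := prod_bound d q hd hq1 y hy2
  set V := ∏ i, (r i - l i) with hV
  have hV0 : 0 < V := prod_pos fun i _ => hx0 i
  set κ := ∑ i, k i with hκ
  have hYV : ∏ i, y i = V * (q:ℝ) ^ κ := by
    rw [hy, prod_mul_distrib, prod_pow_eq_pow_sum]
  have hY1 : ∏ i, y i ≤ 1 := prod_le_one (fun i _ => (hy0 i).le) (fun i _ => hk1 i)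
  have hY2 : 1 ≤ (∏ i, y i) * (q:ℝ) ^ (2 * d) := by
    have : (∏ i, y i) * (q:ℝ) ^ (2 * d) = ∏ i, (y i * (q:ℝ) ^ 2) := by
      exact prod_mul_sq d q y
    rw [this]
    have h := prod_le_prod (s := (univ : Finset (Fin d))) (f := fun _ => (1:ℝ))
      (g := fun i => y i * (q:ℝ) ^ 2) (fun _ _ => zero_le_one) (fun i _ => hy2 i)
    simpa using h
  have hκ1 : κ < 6 * d + rr := by
    have h1 : (q:ℝ) ^ κ < n := by
      rw [hYV] at hY1
      have h2 : 1 < V * n := by nlinarith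
      have : 0 < (q:ℝ) ^ κ := by positivity
      by_contra hc
      push Not at hc
      nlinarith
    have h2 : q ^ κ < q ^ (6 * d + rr) := by
      have : q ^ κ < n := by exact_mod_cast h1
      omega
    exact (Nat.pow_lt_pow_iff_right hqp.one_lt).1 h2
  have hbound : ∀ n0, 4 * d ≤ n0 → 77 * d * Real.log d * (q:ℝ) ^ (10 * d) ≤
      1 / 2 * (∏ i, y i) * (q:ℝ) ^ n0 * N → 77 * d * Real.log d * (q:ℝ) ^ (10 * d) ≤
      (∏ i, ((r i - l i) * (q:ℝ) ^ (k i + 4) - 2)) * (q:ℝ) ^ (n0 - 4 * d) * N := by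
    intro n0 h4 h
    refine h.trans ?_
    simp only [e4]
    have : (q:ℝ) ^ n0 = (q:ℝ) ^ (4 * d) * (q:ℝ) ^ (n0 - 4 * d) := by rw [← pow_add]; congr 1; omega
    rw [this, ← mul_assoc]
    gcongr
  obtain ⟨n0, h4, h10, hm, hbig⟩ : ∃ n0, 4 * d ≤ n0 ∧ n0 ≤ 10 * d ∧ κ + n0 ≤ 10 * d + rr ∧
      77 * d * Real.log d * (q:ℝ) ^ (10 * d) ≤ 1 / 2 * (∏ i, y i) * (q:ℝ) ^ n0 * N := by
    by_cases hc : rr ≤ κ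
    · refine ⟨10 * d + rr - κ, by omega, by omega, by omega, ?_⟩
      have e : (∏ i, y i) * (q:ℝ) ^ (10 * d + rr - κ) = V * ((q:ℝ) ^ rr * (q:ℝ) ^ (10 * d)) := by
        rw [hYV, mul_assoc, ← pow_add, ← pow_add]; congr 2; omega
      rw [mul_assoc (1 / 2 : ℝ), e]
      have h1 : 77 * d * Real.log d ≤ 1 / 2 * V * (q:ℝ) ^ rr * N := by
        have h2 : V * n ≤ V * (2 * N * ((d + 1) * (q:ℝ) ^ rr)) := by gcongr
        have h3 : 77 * d * Real.log d * (d + 1) * 4 ≤ 8000 * (d:ℝ)^2 * Real.log d := by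
          have : 0 ≤ d * Real.log d := by positivity
          nlinarith
        have h5 : 77 * d * Real.log d * (4 * ((d:ℝ) + 1)) ≤ (1 / 2 * V * (q:ℝ) ^ rr * N) * (4 * ((d:ℝ) + 1)) := by
          have e1 : (1 / 2 * V * (q:ℝ) ^ rr * N) * (4 * ((d:ℝ) + 1)) =
            V * (2 * N * ((d + 1) * (q:ℝ) ^ rr)) := by ring
          have e2 : 77 * d * Real.log d * (4 * ((d:ℝ) + 1)) =
            77 * d * Real.log d * (d + 1) * 4 := by ring
          rw [e1, e2]
          exact h3.trans (hvol.le.trans h2)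
        exact le_of_mul_le_mul_right h5 (by positivity)
      have h6 : (0:ℝ) < (q:ℝ) ^ (10 * d) := by positivity
      calc _ ≤ (1 / 2 * V * (q:ℝ) ^ rr * N) * (q:ℝ) ^ (10 * d) := by gcongr
        _ = _ := by ring
    · refine ⟨10 * d, by omega, le_rfl, by omega, ?_⟩
      have hr3 := hr2.resolve_left (by omega)
      have hr4 : (q:ℝ) ^ (6 * d) * (q:ℝ) ^ rr < n * q := by
        rw [← pow_add]; exact_mod_cast hr3
      have hrp : (0:ℝ) < (q:ℝ) ^ rr := by positivity
      have h1 : (q:ℝ) ^ (6 * d) ≤ 2 * N * (q:ℝ) ^ 2 := by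
        apply le_of_mul_le_mul_right _ hrp
        calc _ ≤ (n:ℝ) * q := hr4.le
          _ ≤ 2 * N * ((d + 1) * (q:ℝ) ^ rr) * q := by gcongr
          _ ≤ 2 * N * (q * (q:ℝ) ^ rr) * q := by gcongr; linarith
          _ = _ := by ring
      set Y := ∏ i, y i
      have hYp : 0 < Y := prod_pos fun i _ => hy0 i
      have h2 : (q:ℝ) ^ 8 * (q:ℝ) ^ 2 * (q:ℝ) ^ 2 ≤ 2 * N * Y * (q:ℝ) ^ 2 := by
        have hp2 : (0:ℝ) < (q:ℝ) ^ (2 * d) := by positivity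
        have h3 : (q:ℝ) ^ (4 * d) * (q:ℝ) ^ (2 * d) ≤ (2 * N * Y * (q:ℝ) ^ 2) * (q:ℝ) ^ (2 * d) := by
          calc (q:ℝ) ^ (4 * d) * (q:ℝ) ^ (2 * d) = (q:ℝ) ^ (6 * d) * 1 := by
                rw [← pow_add, mul_one]; congr 1; ring
            _ ≤ (2 * N * (q:ℝ) ^ 2) * (Y * (q:ℝ) ^ (2 * d)) := by gcongr
            _ = _ := by ring
        refine le_trans ?_ (le_of_mul_le_mul_right h3 hp2)
        rw [← pow_add, ← pow_add]
        exact pow_le_pow_right₀ (by linarith) (by omega)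
      have h3 : (q:ℝ) ^ 8 * (q:ℝ) ^ 2 ≤ 2 * N * Y := le_of_mul_le_mul_right h2 (by positivity)
      have h5 : (5:ℝ) ^ 8 ≤ (q:ℝ) ^ 8 := by gcongr
      have h6 : d * Real.log d ≤ (q:ℝ) ^ 2 := by
        have : d * Real.log d ≤ (q:ℝ) * q := by gcongr <;> linarith
        rwa [sq]
      have h7 : 77 * d * Real.log d ≤ 1 / 2 * Y * N := by
        have : (5:ℝ) ^ 8 * (q:ℝ) ^ 2 ≤ (q:ℝ) ^ 8 * (q:ℝ) ^ 2 := by gcongr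
        have h8 : 0 ≤ (q:ℝ) ^ 2 := by positivity
        norm_num at this
        linarith
      calc _ ≤ (1 / 2 * Y * N) * (q:ℝ) ^ (10 * d) := by gcongr
        _ = _ := by ring
  obtain ⟨s, t, w, hstw⟩ := box_hit q hcop a ha ha0 (10 * d) rr N _ α hα l r
    (fun i => (hlr i).1) (fun i => (hlr i).2.2) k hk1 hk2
    (fun i => by
      rw [e4]
      have h1 := hy2 i
      have : (2:ℝ) ≤ (q:ℝ) ^ 2 := by nlinarith
      have e : y i * (q:ℝ) ^ 4 = (y i * (q:ℝ) ^ 2) * (q:ℝ) ^ 2 := by ring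
      rw [e]; nlinarith)
    n0 h4 h10 hm (hbound n0 h4 hbig)
  exact ⟨_, mem_image_of_mem _ (mem_univ (s, t, w)), hstw⟩
end
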